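/- Let r, s ≥ 2, let k ≥ 1, let R' and R'' be algebraic Kähler curvature tensors on ℂ^r and ℂ^s respectively, and let R be their product tensor on Fin r ⊕ Fin s. Then CQB_R(A) ≥ 0 for every matrix A over Fin r ⊕ Fin s of rank at most k if and only if CQB_{R'}(A') ≥ 0 for every A' over Fin r of rank at most k and CQB_{R''}(A'') ≥ 0 for every A'' over Fin s of rank at most k. Likewise, CQB_R(A) > 0 for every nonzero A of rank at most k if and only if the same strict positivity holds for both R' and R''. (Corollary 2.2 of the paper, pointwise/algebraic form; the hypotheses r, s ≥ 2 make the factorwise Ricci positivity available.) -/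

import Mathlib

open Finset

/-- An algebraic Kähler curvature tensor over a finite index type. -/
def IsKahlerCurv {ι : Type} [Fintype ι] (R : ι → ι → ι → ι → ℂ) : Prop :=
  (∀ a b c d, R a b c d = R c b a d) ∧
  (∀ a b c d, R a b c d = R a d c b) ∧
  (∀ a b c d, star (R a b c d) = R b a d c)

/-- The Ricci tensor `Ric a b = ∑ c, R a b c c`. -/
noncomputable def ricT {ι : Type} [Fintype ι] (R : ι → ι → ι → ι → ℂ) (a b : ι) : ℂ :=
  ∑ c, R a b c c

/-- The cross quadratic bisectional curvature quadratic form on matrices. -/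
noncomputable def CQB {ι : Type} [Fintype ι] (R : ι → ι → ι → ι → ℂ)
    (A : Matrix ι ι ℂ) : ℝ :=
  ((∑ a, ∑ b, ∑ c, ricT R a b * A c a * star (A c b)) -
    (∑ a, ∑ b, ∑ c, ∑ d, R a b c d * A a c * star (A b d))).re

/-- The dual cross quadratic bisectional curvature quadratic form on matrices. -/
noncomputable def dCQB {ι : Type} [Fintype ι] (R : ι → ι → ι → ι → ℂ)
    (A : Matrix ι ι ℂ) : ℝ :=
  ((∑ a, ∑ c, ∑ d, ricT R c d * star (A c a) * A d a) +
    (∑ a, ∑ b, ∑ c, ∑ d, R a b c d * star (A c a) * A d b)).re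

/-- The product of two algebraic curvature tensors, indexed by `Fin r ⊕ Fin s`. -/
def prodCurv {r s : ℕ} (R' : Fin r → Fin r → Fin r → Fin r → ℂ)
    (R'' : Fin s → Fin s → Fin s → Fin s → ℂ) :
    (Fin r ⊕ Fin s) → (Fin r ⊕ Fin s) → (Fin r ⊕ Fin s) → (Fin r ⊕ Fin s) → ℂ
  | .inl i, .inl j, .inl k, .inl l => R' i j k l
  | .inr a, .inr b, .inr c, .inr d => R'' a b c d
  | _, _, _, _ => 0

/-- The Hermitian form `v ↦ Re (∑ Ric a b v_a conj v_b)` of the Ricci tensor. -/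
noncomputable def ricForm {ι : Type} [Fintype ι] (R : ι → ι → ι → ι → ℂ) (v : ι → ℂ) : ℝ :=
  (∑ a, ∑ b, ricT R a b * v a * star (v b)).re

theorem cqb_zero {ι : Type} [Fintype ι] (R : ι → ι → ι → ι → ℂ) : CQB R 0 = 0 := by
  simp [CQB]

theorem ricForm_zero {ι : Type} [Fintype ι] (R : ι → ι → ι → ι → ℂ) : ricForm R 0 = 0 := by
  simp [ricForm]

theorem IsKahlerCurv.sum_diag {ι : Type} [Fintype ι] {R : ι → ι → ι → ι → ℂ}
    (hR : IsKahlerCurv R) (c d : ι) : ∑ a, R a a c d = ricT R c d := by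
  refine sum_congr rfl fun a _ => ?_
  rw [hR.1, hR.2.1]

theorem cqb_single_row {ι : Type} [Fintype ι] [DecidableEq ι] (R : ι → ι → ι → ι → ℂ)
    (i : ι) (v : ι → ℂ) :
    CQB R (Matrix.vecMulVec (Pi.single i 1) v) =
      ricForm R v - (∑ c, ∑ d, R i i c d * v c * star (v d)).re := by
  rw [CQB, ricForm, Complex.sub_re]
  congr 2
  · simp [Matrix.vecMulVec_apply, Pi.single_apply]
  · rw [sum_eq_single i (fun j _ hj => by simp [Matrix.vecMulVec_apply, hj]) (by simp),
      sum_eq_single i (fun j _ hj => by simp [Matrix.vecMulVec_apply, hj]) (by simp)]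
    simp [Matrix.vecMulVec_apply]

theorem IsKahlerCurv.sum_cqb_single_row {ι : Type} [Fintype ι] [DecidableEq ι]
    {R : ι → ι → ι → ι → ℂ} (hR : IsKahlerCurv R) (v : ι → ℂ) :
    ∑ i, CQB R (Matrix.vecMulVec (Pi.single i 1) v) =
      ((Fintype.card ι : ℝ) - 1) * ricForm R v := by
  have h : ∑ i, ∑ c, ∑ d, R i i c d * v c * star (v d) =
      ∑ a, ∑ b, ricT R a b * v a * star (v b) := by
    rw [sum_comm]
    refine sum_congr rfl fun c _ => ?_
    rw [sum_comm]
    refine sum_congr rfl fun d _ => ?_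
    rw [← sum_mul, ← sum_mul, hR.sum_diag]
  simp only [cqb_single_row, sum_sub_distrib, ← Complex.re_sum, h, sum_const, card_univ,
    nsmul_eq_mul]
  rw [sub_mul, one_mul, ricForm]

theorem IsKahlerCurv.ricForm_nonneg {ι : Type} [Fintype ι] {R : ι → ι → ι → ι → ℂ}
    (hR : IsKahlerCurv R) (hι : 1 < Fintype.card ι)
    (h : ∀ A : Matrix ι ι ℂ, A.rank ≤ 1 → 0 ≤ CQB R A) (v : ι → ℂ) : 0 ≤ ricForm R v := by
  classical
  have hι' : (0 : ℝ) < Fintype.card ι - 1 := sub_pos.2 (by exact_mod_cast hι)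
  refine nonneg_of_mul_nonneg_right ?_ hι'
  rw [← hR.sum_cqb_single_row]
  exact sum_nonneg fun i _ => h _ (Matrix.rank_vecMulVec_le _ _)

theorem IsKahlerCurv.ricForm_pos {ι : Type} [Fintype ι] {R : ι → ι → ι → ι → ℂ}
    (hR : IsKahlerCurv R) (hι : 1 < Fintype.card ι)
    (h : ∀ A : Matrix ι ι ℂ, A ≠ 0 → A.rank ≤ 1 → 0 < CQB R A) {v : ι → ℂ} (hv : v ≠ 0) :
    0 < ricForm R v := by
  classical
  have hι' : (0 : ℝ) < Fintype.card ι - 1 := sub_pos.2 (by exact_mod_cast hι)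
  refine pos_of_mul_pos_right ?_ hι'.le
  rw [← hR.sum_cqb_single_row]
  have : Nonempty ι := Fintype.card_pos_iff.1 (by omega)
  refine sum_pos (fun i _ => h _ (fun h0 => hv ?_) (Matrix.rank_vecMulVec_le _ _))
    univ_nonempty
  ext j
  simpa [Matrix.vecMulVec_apply] using congrFun (congrFun h0 i) j

theorem ricT_prodCurv_inl_inl {r s : ℕ} (R' : Fin r → Fin r → Fin r → Fin r → ℂ)
    (R'' : Fin s → Fin s → Fin s → Fin s → ℂ) (i j : Fin r) :
    ricT (prodCurv R' R'') (.inl i) (.inl j) = ricT R' i j := by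
  simp [ricT, prodCurv]

theorem ricT_prodCurv_inr_inr {r s : ℕ} (R' : Fin r → Fin r → Fin r → Fin r → ℂ)
    (R'' : Fin s → Fin s → Fin s → Fin s → ℂ) (i j : Fin s) :
    ricT (prodCurv R' R'') (.inr i) (.inr j) = ricT R'' i j := by
  simp [ricT, prodCurv]

theorem ricT_prodCurv_inl_inr {r s : ℕ} (R' : Fin r → Fin r → Fin r → Fin r → ℂ)
    (R'' : Fin s → Fin s → Fin s → Fin s → ℂ) (i : Fin r) (j : Fin s) :
    ricT (prodCurv R' R'') (.inl i) (.inr j) = 0 := by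
  simp [ricT, prodCurv]

theorem ricT_prodCurv_inr_inl {r s : ℕ} (R' : Fin r → Fin r → Fin r → Fin r → ℂ)
    (R'' : Fin s → Fin s → Fin s → Fin s → ℂ) (i : Fin s) (j : Fin r) :
    ricT (prodCurv R' R'') (.inr i) (.inl j) = 0 := by
  simp [ricT, prodCurv]

theorem sum_ricForm {ι κ : Type} [Fintype ι] [Fintype κ] (R : ι → ι → ι → ι → ℂ)
    (A : Matrix κ ι ℂ) :
    ∑ c, ricForm R (A c) = (∑ a, ∑ b, ∑ c, ricT R a b * A c a * star (A c b)).re := by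
  simp only [ricForm, ← Complex.re_sum]
  rw [sum_comm]
  simp only [sum_comm (s := (univ : Finset κ))]

theorem sum_ricForm_pos {ι κ : Type} [Fintype ι] [Fintype κ] {R : ι → ι → ι → ι → ℂ}
    {A : Matrix κ ι ℂ} (h : ∀ v : ι → ℂ, v ≠ 0 → 0 < ricForm R v) (hA : A ≠ 0) :
    0 < ∑ c, ricForm R (A c) := by
  obtain ⟨c, hc⟩ := Function.ne_iff.1 hA
  refine sum_pos' (fun d _ => ?_) ⟨c, mem_univ c, h _ hc⟩
  rcases eq_or_ne (A d) 0 with h0 | h0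
  · rw [h0, ricForm_zero]
  · exact (h _ h0).le

theorem cqb_prodCurv_fromBlocks {r s : ℕ} (R' : Fin r → Fin r → Fin r → Fin r → ℂ)
    (R'' : Fin s → Fin s → Fin s → Fin s → ℂ)
    (P : Matrix (Fin r) (Fin r) ℂ) (Q : Matrix (Fin r) (Fin s) ℂ)
    (S : Matrix (Fin s) (Fin r) ℂ) (T : Matrix (Fin s) (Fin s) ℂ) :
    CQB (prodCurv R' R'') (Matrix.fromBlocks P Q S T) =
      CQB R' P + CQB R'' T + ∑ c, ricForm R' (S c) + ∑ c, ricForm R'' (Q c) := by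
  simp only [sum_ricForm, CQB, Fintype.sum_sum_type, ricT_prodCurv_inl_inl,
    ricT_prodCurv_inr_inr, ricT_prodCurv_inl_inr, ricT_prodCurv_inr_inl,
    Matrix.fromBlocks_apply₁₁, Matrix.fromBlocks_apply₁₂, Matrix.fromBlocks_apply₂₁,
    Matrix.fromBlocks_apply₂₂, prodCurv, zero_mul, sum_const_zero, add_zero, zero_add,
    sum_add_distrib, Complex.add_re, Complex.sub_re]
  ring

theorem rank_fromBlocks_zero₁₁ {m n : Type} [Fintype m] [Fintype n] [DecidableEq m]
    (P : Matrix m m ℂ) :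
    (Matrix.fromBlocks P 0 0 (0 : Matrix n n ℂ)).rank ≤ P.rank := by
  have h : Matrix.fromBlocks P 0 0 (0 : Matrix n n ℂ) =
      Matrix.fromRows (1 : Matrix m m ℂ) 0 * (P * Matrix.fromCols (1 : Matrix m m ℂ) 0) := by
    ext (i | i) (j | j) <;> simp [Matrix.mul_fromCols, Matrix.fromRows_mul]
  rw [h]
  exact (Matrix.rank_mul_le_right _ _).trans (Matrix.rank_mul_le_left _ _)

theorem rank_fromBlocks_zero₂₂ {m n : Type} [Fintype m] [Fintype n] [DecidableEq n]
    (T : Matrix n n ℂ) :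
    (Matrix.fromBlocks (0 : Matrix m m ℂ) 0 0 T).rank ≤ T.rank := by
  have h : Matrix.fromBlocks (0 : Matrix m m ℂ) 0 0 T =
      Matrix.fromRows 0 (1 : Matrix n n ℂ) * (T * Matrix.fromCols 0 (1 : Matrix n n ℂ)) := by
    ext (i | i) (j | j) <;> simp [Matrix.mul_fromCols, Matrix.fromRows_mul]
  rw [h]
  exact (Matrix.rank_mul_le_right _ _).trans (Matrix.rank_mul_le_left _ _)

theorem rank_le_rank_fromBlocks₁₁ {m n : Type} [Fintype m] [Fintype n]
    (P : Matrix m m ℂ) (Q : Matrix m n ℂ) (S : Matrix n m ℂ) (T : Matrix n n ℂ) :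
    P.rank ≤ (Matrix.fromBlocks P Q S T).rank :=
  (Matrix.fromBlocks P Q S T).rank_submatrix_le Sum.inl Sum.inl

theorem rank_le_rank_fromBlocks₂₂ {m n : Type} [Fintype m] [Fintype n]
    (P : Matrix m m ℂ) (Q : Matrix m n ℂ) (S : Matrix n m ℂ) (T : Matrix n n ℂ) :
    T.rank ≤ (Matrix.fromBlocks P Q S T).rank :=
  (Matrix.fromBlocks P Q S T).rank_submatrix_le Sum.inr Sum.inr

theorem cqb_prodCurv_embed₁₁ {r s : ℕ} (R' : Fin r → Fin r → Fin r → Fin r → ℂ)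
    (R'' : Fin s → Fin s → Fin s → Fin s → ℂ) (P : Matrix (Fin r) (Fin r) ℂ) :
    CQB (prodCurv R' R'') (Matrix.fromBlocks P 0 0 0) = CQB R' P := by
  rw [cqb_prodCurv_fromBlocks, cqb_zero]
  simp [sum_ricForm]

theorem cqb_prodCurv_embed₂₂ {r s : ℕ} (R' : Fin r → Fin r → Fin r → Fin r → ℂ)
    (R'' : Fin s → Fin s → Fin s → Fin s → ℂ) (T : Matrix (Fin s) (Fin s) ℂ) :
    CQB (prodCurv R' R'') (Matrix.fromBlocks 0 0 0 T) = CQB R'' T := by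
  rw [cqb_prodCurv_fromBlocks, cqb_zero]
  simp [sum_ricForm]

/-- Corollary 2.2: a product tensor has `CQB_k ≥ 0` (resp. `CQB_k > 0`) iff both
factors do. -/
theorem cqb_prod_pos_iff (r s k : ℕ) (hr : 2 ≤ r) (hs : 2 ≤ s) (hk : 1 ≤ k)
    (R' : Fin r → Fin r → Fin r → Fin r → ℂ)
    (R'' : Fin s → Fin s → Fin s → Fin s → ℂ)
    (hR' : IsKahlerCurv R') (hR'' : IsKahlerCurv R'') :
    ((∀ A : Matrix (Fin r ⊕ Fin s) (Fin r ⊕ Fin s) ℂ,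
        A.rank ≤ k → 0 ≤ CQB (prodCurv R' R'') A) ↔
      ((∀ A' : Matrix (Fin r) (Fin r) ℂ, A'.rank ≤ k → 0 ≤ CQB R' A') ∧
       (∀ A'' : Matrix (Fin s) (Fin s) ℂ, A''.rank ≤ k → 0 ≤ CQB R'' A''))) ∧
    ((∀ A : Matrix (Fin r ⊕ Fin s) (Fin r ⊕ Fin s) ℂ,
        A ≠ 0 → A.rank ≤ k → 0 < CQB (prodCurv R' R'') A) ↔
      ((∀ A' : Matrix (Fin r) (Fin r) ℂ, A' ≠ 0 → A'.rank ≤ k → 0 < CQB R' A') ∧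
       (∀ A'' : Matrix (Fin s) (Fin s) ℂ, A'' ≠ 0 → A''.rank ≤ k → 0 < CQB R'' A''))) := by
  have hr' : 1 < Fintype.card (Fin r) := by rwa [Fintype.card_fin]
  have hs' : 1 < Fintype.card (Fin s) := by rwa [Fintype.card_fin]
  refine ⟨⟨fun h => ⟨fun P hP => ?_, fun T hT => ?_⟩, fun ⟨h', h''⟩ A hA => ?_⟩,
    ⟨fun h => ⟨fun P hP0 hP => ?_, fun T hT0 hT => ?_⟩, fun ⟨h', h''⟩ A hA0 hA => ?_⟩⟩
  · rw [← cqb_prodCurv_embed₁₁ R' R'']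
    exact h _ ((rank_fromBlocks_zero₁₁ P).trans hP)
  · rw [← cqb_prodCurv_embed₂₂ R' R'']
    exact h _ ((rank_fromBlocks_zero₂₂ T).trans hT)
  · obtain ⟨P, Q, S, T, rfl⟩ : ∃ P Q S T, A = Matrix.fromBlocks P Q S T :=
      ⟨_, _, _, _, A.fromBlocks_toBlocks.symm⟩
    have hP := h' P ((rank_le_rank_fromBlocks₁₁ P Q S T).trans hA)
    have hT := h'' T ((rank_le_rank_fromBlocks₂₂ P Q S T).trans hA)
    have hS : 0 ≤ ∑ c, ricForm R' (S c) := sum_nonneg fun c _ =>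
      hR'.ricForm_nonneg hr' (fun B hB => h' B (hB.trans hk)) _
    have hQ : 0 ≤ ∑ c, ricForm R'' (Q c) := sum_nonneg fun c _ =>
      hR''.ricForm_nonneg hs' (fun B hB => h'' B (hB.trans hk)) _
    rw [cqb_prodCurv_fromBlocks]
    positivity
  · rw [← cqb_prodCurv_embed₁₁ R' R'']
    refine h _ (fun h0 => hP0 ?_) ((rank_fromBlocks_zero₁₁ P).trans hP)
    exact (Matrix.fromBlocks_inj.1 (h0.trans Matrix.fromBlocks_zero.symm)).1
  · rw [← cqb_prodCurv_embed₂₂ R' R'']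
    refine h _ (fun h0 => hT0 ?_) ((rank_fromBlocks_zero₂₂ T).trans hT)
    exact (Matrix.fromBlocks_inj.1 (h0.trans Matrix.fromBlocks_zero.symm)).2.2.2
  · obtain ⟨P, Q, S, T, rfl⟩ : ∃ P Q S T, A = Matrix.fromBlocks P Q S T :=
      ⟨_, _, _, _, A.fromBlocks_toBlocks.symm⟩
    have hP (hP0 : P ≠ 0) := h' P hP0 ((rank_le_rank_fromBlocks₁₁ P Q S T).trans hA)
    have hT (hT0 : T ≠ 0) := h'' T hT0 ((rank_le_rank_fromBlocks₂₂ P Q S T).trans hA)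
    have hS := sum_ricForm_pos (A := S) fun v hv =>
      hR'.ricForm_pos hr' (fun B hB0 hB => h' B hB0 (hB.trans hk)) hv
    have hQ := sum_ricForm_pos (A := Q) fun v hv =>
      hR''.ricForm_pos hs' (fun B hB0 hB => h'' B hB0 (hB.trans hk)) hv
    have hP' : 0 ≤ CQB R' P := by
      rcases eq_or_ne P 0 with rfl | h0
      exacts [(cqb_zero R').ge, (hP h0).le]
    have hT' : 0 ≤ CQB R'' T := by
      rcases eq_or_ne T 0 with rfl | h0
      exacts [(cqb_zero R'').ge, (hT h0).le]
    have hS' : 0 ≤ ∑ c, ricForm R' (S c) := by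
      rcases eq_or_ne S 0 with rfl | h0
      exacts [(sum_eq_zero fun _ _ => ricForm_zero R').ge, (hS h0).le]
    have hQ' : 0 ≤ ∑ c, ricForm R'' (Q c) := by
      rcases eq_or_ne Q 0 with rfl | h0
      exacts [(sum_eq_zero fun _ _ => ricForm_zero R'').ge, (hQ h0).le]
    rw [cqb_prodCurv_fromBlocks]
    by_cases hP0 : P = 0
    · by_cases hT0 : T = 0
      · by_cases hS0 : S = 0
        · have hQ0 : Q ≠ 0 := by
            rintro rfl
            exact hA0 (by rw [hP0, hT0, hS0, Matrix.fromBlocks_zero])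
          linarith [hQ hQ0]
        · linarith [hS hS0]
      · linarith [hT hT0]
    · linarith [hP hP0]
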